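/- Let H be a graph of maximum degree Δ ≥ 3, v a vertex of H, and S a set of c vertices of H with v ∉ S. Then ∑_{w∈S} dist_H(v,w) ≥ c·h + Δ·h/(Δ−2) − Δ·((Δ−1)^h − 1)/(Δ−2)², where h = 1 + ⌊log_{Δ−1}⌈c/Δ⌉⌋. -/

import Mathlib

theorem aux_pred {V : Type*} (H : SimpleGraph V) (hconn : H.Connected) (v w : V) (i : ℕ)
    (hw : H.dist v w = i + 1) : ∃ u, H.Adj u w ∧ H.dist v u = i := by
  obtain ⟨p, hp⟩ := hconn.exists_walk_length_eq_dist w v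
  rw [SimpleGraph.dist_comm, hw] at hp
  cases p with
  | nil => simp at hp
  | @cons _ u _ ha q =>
    refine ⟨u, ha.symm, ?_⟩
    have h1 : H.dist u v ≤ i := by
      have := SimpleGraph.dist_le q
      simp at hp
      omega
    have h2 := hconn.dist_triangle (u := v) (v := u) (w := w)
    have h3 : H.dist u w ≤ 1 := by
      have := SimpleGraph.dist_le ha.symm.toWalk
      simpa using this
    rw [SimpleGraph.dist_comm] at h1
    omega

open Classical in
theorem aux_layer {V : Type*} [Fintype V] (H : SimpleGraph V) (hconn : H.Connected)
    (Δ : ℕ) (hΔ : 3 ≤ Δ) (hdeg : ∀ v : V, (H.neighborSet v).ncard ≤ Δ) (v : V) (i : ℕ) :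
    (Finset.univ.filter (fun w => H.dist v w = i + 1)).card ≤ Δ * (Δ - 1) ^ i := by
  have hdeg' : ∀ u : V, (Finset.univ.filter (fun w => H.Adj u w)).card ≤ Δ := by
    intro u
    have := hdeg u
    rw [← Set.ncard_coe_finset]
    convert this using 2
    ext w; simp
  induction i with
  | zero =>
    simp only [pow_zero, mul_one]
    refine le_trans (Finset.card_le_card ?_) (hdeg' v)
    intro w hw
    simp only [Finset.mem_filter, Finset.mem_univ, true_and, zero_add] at hw ⊢
    exact SimpleGraph.dist_eq_one_iff_adj.mp hw
  | succ i ih =>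
    have hsub : (Finset.univ.filter (fun w => H.dist v w = i + 1 + 1)) ⊆
        (Finset.univ.filter (fun w => H.dist v w = i + 1)).biUnion
          (fun u => Finset.univ.filter (fun w => H.Adj u w ∧ H.dist v w = i + 1 + 1)) := by
      intro w hw
      simp only [Finset.mem_filter, Finset.mem_univ, true_and, Finset.mem_biUnion] at hw ⊢
      obtain ⟨u, hu, hd⟩ := aux_pred H hconn v w (i + 1) hw
      exact ⟨u, hd, hu, hw⟩
    refine (Finset.card_le_card hsub).trans ?_
    refine (Finset.card_biUnion_le_card_mul _ _ (Δ - 1) ?_).trans ?_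
    · intro u hu
      simp only [Finset.mem_filter, Finset.mem_univ, true_and] at hu
      obtain ⟨t, ht, hd⟩ := aux_pred H hconn v u i hu
      have hlt : (Finset.univ.filter (fun w => H.Adj u w ∧ H.dist v w = i + 1 + 1)).card <
          (Finset.univ.filter (fun w => H.Adj u w)).card := by
        apply Finset.card_lt_card
        rw [Finset.ssubset_iff_of_subset]
        · refine ⟨t, by simpa using ht.symm, ?_⟩
          simp only [Finset.mem_filter, Finset.mem_univ, true_and, hd]
          omega
        · intro w hw
          simp only [Finset.mem_filter, Finset.mem_univ, true_and] at hw ⊢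
          exact hw.1
      have := hdeg' u
      omega
    · rw [pow_succ, ← mul_assoc]
      exact Nat.mul_le_mul_right _ ih

open Classical in
theorem aux_ball {V : Type*} [Fintype V] (H : SimpleGraph V) (hconn : H.Connected)
    (Δ : ℕ) (hΔ : 3 ≤ Δ) (hdeg : ∀ v : V, (H.neighborSet v).ncard ≤ Δ) (v : V)
    (S : Finset V) (hvS : v ∉ S) (h : ℕ) :
    ((S.filter (fun w => H.dist v w ≤ h)).card : ℝ)
      ≤ (Δ : ℝ) * (((Δ : ℝ) - 1) ^ h - 1) / ((Δ : ℝ) - 2) := by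
  have h3 : (3 : ℝ) ≤ Δ := by exact_mod_cast hΔ
  have hne : (Δ : ℝ) - 2 ≠ 0 := by linarith
  induction h with
  | zero =>
    have : S.filter (fun w => H.dist v w ≤ 0) = ∅ := by
      apply Finset.filter_eq_empty_iff.mpr
      intro w hw hd
      have := hconn.dist_eq_zero_iff.mp (Nat.le_zero.mp hd)
      exact hvS (this ▸ hw)
    rw [this]; simp
  | succ h ih =>
    have hsub : S.filter (fun w => H.dist v w ≤ h + 1) ⊆ S.filter (fun w => H.dist v w ≤ h) ∪
        Finset.univ.filter (fun w => H.dist v w = h + 1) := by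
      intro w hw
      simp only [Finset.mem_filter, Finset.mem_univ, true_and, Finset.mem_union] at hw ⊢
      rcases Nat.lt_or_ge h (H.dist v w) with h1 | h1
      · right; omega
      · left; exact ⟨hw.1, h1⟩
    have h1 := (Finset.card_le_card hsub).trans (Finset.card_union_le _ _)
    have h2 := aux_layer H hconn Δ hΔ hdeg v h
    have h4 : ((S.filter (fun w => H.dist v w ≤ h + 1)).card : ℝ) ≤
        (S.filter (fun w => H.dist v w ≤ h)).card + (Δ : ℝ) * ((Δ : ℝ) - 1) ^ h := by
      have h5 : (S.filter (fun w => H.dist v w ≤ h + 1)).card ≤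
        (S.filter (fun w => H.dist v w ≤ h)).card + Δ * (Δ - 1) ^ h := by omega
      have h6 : ((Δ - 1 : ℕ) : ℝ) = (Δ : ℝ) - 1 := by
        rw [Nat.cast_sub (by omega)]; simp
      rw [← h6]
      exact_mod_cast h5
    refine h4.trans ((add_le_add_left ih _).trans (le_of_eq ?_))
    field_simp
    ring

theorem aux_main {V : Type*} [Fintype V] (H : SimpleGraph V) (hconn : H.Connected)
    (Δ : ℕ) (hΔ : 3 ≤ Δ) (hdeg : ∀ v : V, (H.neighborSet v).ncard ≤ Δ)
    (v : V) (S : Finset V) (hvS : v ∉ S) (h : ℕ) :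
    (S.card : ℝ) * h + (Δ : ℝ) * h / ((Δ : ℝ) - 2)
        - (Δ : ℝ) * (((Δ : ℝ) - 1) ^ h - 1) / ((Δ : ℝ) - 2) ^ 2
      ≤ ∑ w ∈ S, (min (H.dist v w) h : ℕ) := by
  classical
  have h3 : (3 : ℝ) ≤ Δ := by exact_mod_cast hΔ
  have hne : (Δ : ℝ) - 2 ≠ 0 := by linarith
  induction h with
  | zero => simp
  | succ h ih =>
    have hb := aux_ball H hconn Δ hΔ hdeg v S hvS h
    have hs : ∑ w ∈ S, min (H.dist v w) (h + 1) + (S.filter (fun w => H.dist v w ≤ h)).card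
        = ∑ w ∈ S, min (H.dist v w) h + S.card := by
      rw [Finset.card_filter, Finset.card_eq_sum_ones, ← Finset.sum_add_distrib,
        ← Finset.sum_add_distrib]
      refine Finset.sum_congr rfl fun w _ => ?_
      split_ifs <;> omega
    have hs' : ((∑ w ∈ S, min (H.dist v w) (h + 1) : ℕ) : ℝ)
        = (∑ w ∈ S, min (H.dist v w) h : ℕ) + S.card
          - (S.filter (fun w => H.dist v w ≤ h)).card := by
      rw [eq_sub_iff_add_eq]
      exact_mod_cast hs
    rw [hs']
    have key : (S.card : ℝ) * ((h + 1 : ℕ) : ℝ) + (Δ : ℝ) * ((h + 1 : ℕ) : ℝ) / ((Δ : ℝ) - 2)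
        - (Δ : ℝ) * (((Δ : ℝ) - 1) ^ (h + 1) - 1) / ((Δ : ℝ) - 2) ^ 2 =
        ((S.card : ℝ) * h + (Δ : ℝ) * h / ((Δ : ℝ) - 2)
        - (Δ : ℝ) * (((Δ : ℝ) - 1) ^ h - 1) / ((Δ : ℝ) - 2) ^ 2) + S.card
        - (Δ : ℝ) * (((Δ : ℝ) - 1) ^ h - 1) / ((Δ : ℝ) - 2) := by
      push_cast
      field_simp
      ring
    rw [key]
    linarith


/- Lemma 1, equation (1): in a connected graph H of maximum degree Δ ≥ 3, for
any vertex v and any set S of c vertices with v ∉ S,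
∑_{w∈S} dist_H(v,w) ≥ c·h + Δ·h/(Δ−2) − Δ·((Δ−1)^h − 1)/(Δ−2)²,
where h = 1 + ⌊log_{Δ−1} ⌈c/Δ⌉⌋.  (For naturals, ⌈c/Δ⌉ = (c+Δ−1)/Δ and
⌊log_b m⌋ = Nat.log b m.) -/
theorem stmt_5 {V : Type*} [Fintype V] (H : SimpleGraph V) (hconn : H.Connected)
    (Δ : ℕ) (hΔ : 3 ≤ Δ) (hdeg : ∀ v : V, (H.neighborSet v).ncard ≤ Δ)
    (v : V) (S : Finset V) (hvS : v ∉ S) (c : ℕ) (hc : S.card = c)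
    (h : ℕ) (hh : h = 1 + Nat.log (Δ - 1) ((c + Δ - 1) / Δ)) :
    (c : ℝ) * h + (Δ : ℝ) * h / ((Δ : ℝ) - 2)
        - (Δ : ℝ) * (((Δ : ℝ) - 1) ^ h - 1) / ((Δ : ℝ) - 2) ^ 2
      ≤ ∑ w ∈ S, (H.dist v w : ℝ) := by
  subst hc
  refine (aux_main H hconn Δ hΔ hdeg v S hvS h).trans ?_
  rw [Nat.cast_sum]
  exact Finset.sum_le_sum fun w _ => by exact_mod_cast min_le_left _ _
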